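/- Let A be a finite-dimensional quasi-hereditary algebra over a field. Then the global dimension of A is at most wfd(A) + gfd(A), where wfd(A) and gfd(A) are the suprema of the Weyl filtration dimensions and good filtration dimensions, respectively, of all finite-dimensional A-modules. -/

import Mathlib

/-!
Interface for a (split) quasi-hereditary algebra `A` over a field `k`,
with weight poset `(Λ, ≤)`, standard modules `Δ λ`, costandard modules `∇ λ`
and simple modules `L λ`.  Ext groups are the right derived functors of the
k-linear Hom functor (`ModuleCat A` has enough injectives), and the good
(resp. Weyl) filtration dimension of a module is defined via the standard
Ext-characterisation: `gfd M` is the greatest `d` such that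
`Ext^d(Δ λ, M) ≠ 0` for some `λ` (resp. `wfd M` the greatest `d` with
`Ext^d(M, ∇ λ) ≠ 0`).
-/

open CategoryTheory CategoryTheory.Limits Opposite

universe u

variable (k : Type u) [Field k] (A : Type u) [Ring A] [Algebra k A]
  [FiniteDimensional k A]
variable (Λ : Type u) [PartialOrder Λ] [Fintype Λ]

/-- `Ext^n_A(X, Y)` as a `k`-module: the `n`-th right derived functor of
`Hom_A(X, -)` applied to `Y`. -/
noncomputable def extA (n : ℕ) (X Y : ModuleCat.{u} A) : ModuleCat.{u} k :=
  (((linearCoyoneda k (ModuleCat.{u} A)).obj (op X)).rightDerived n).obj Y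

/-- `M` has a filtration `0 = M₀ ⊆ M₁ ⊆ ⋯ ⊆ Mₙ = M` whose successive quotients
are isomorphic to members of the family `F`. -/
def ModuleFilteredBy (M : ModuleCat.{u} A) (F : Set (ModuleCat.{u} A)) : Prop :=
  ∃ (n : ℕ) (c : Fin (n + 1) → Submodule A M), Monotone c ∧ c 0 = ⊥ ∧ c (Fin.last n) = ⊤ ∧
    ∀ i : Fin n, ∃ N ∈ F,
      Nonempty ((↥(c i.succ) ⧸ (Submodule.comap (c i.succ).subtype (c i.castSucc))) ≃ₗ[A] N)

/-- A quasi-hereditary structure on the finite-dimensional algebra `A` with weight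
poset `Λ`: the data of standard modules `Δ`, costandard modules `∇` (`nabla`) and
simple modules `L`, subject to the standard axioms (Dlab–Ringel / Donkin A2.2):
`Δ λ` has simple head `L λ`, `∇ λ` has simple socle `L λ`,
`Hom(Δ λ, ∇ μ) = δ_{λμ}·k`, `Ext^n(Δ λ, ∇ μ) = 0` for `n ≥ 1`,
`Hom(Δ λ, Δ μ) ≠ 0 ⟹ λ ≤ μ`, `Ext¹(Δ λ, Δ μ) ≠ 0 ⟹ λ < μ`, and `A` itself
(as a left module) has a filtration by standard modules. -/
structure QuasiHereditaryData where
  Δ : Λ → ModuleCat.{u} A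
  nabla : Λ → ModuleCat.{u} A
  L : Λ → ModuleCat.{u} A
  finΔ : ∀ l, Module.Finite A (Δ l)
  finNabla : ∀ l, Module.Finite A (nabla l)
  finL : ∀ l, Module.Finite A (L l)
  simpleL : ∀ l, Simple (L l)
  simple_complete : ∀ M : ModuleCat.{u} A, Module.Finite A M → Simple M →
    ∃ l, Nonempty (M ≅ L l)
  L_inj : ∀ l m, Nonempty (L l ≅ L m) → l = m
  headΔ : ∀ l, ∃ f : Δ l ⟶ L l, Epi f
  socleNabla : ∀ l, ∃ f : L l ⟶ nabla l, Mono f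
  hom_self : ∀ l, Nonempty ((Δ l ⟶ nabla l) ≃ₗ[k] k)
  hom_ne : ∀ l m, l ≠ m → Subsingleton (Δ l ⟶ nabla m)
  ext_delta_nabla : ∀ n, 0 < n → ∀ l m, IsZero (extA k A n (Δ l) (nabla m))
  hom_delta_order : ∀ l m, ¬ Subsingleton (Δ l ⟶ Δ m) → l ≤ m
  ext_delta_order : ∀ l m, ¬ IsZero (extA k A 1 (Δ l) (Δ m)) → l < m
  A_filtered : ModuleFilteredBy A (ModuleCat.of A A) (Set.range Δ)

variable {k A Λ}

namespace QuasiHereditaryData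

variable (Q : QuasiHereditaryData k A Λ)

/-- The good filtration dimension of `M`: the greatest `d` such that
`Ext^d(Δ λ, M) ≠ 0` for some `λ ∈ Λ`. -/
noncomputable def gfd (M : ModuleCat.{u} A) : ℕ :=
  sSup {d | ∃ l, ¬ IsZero (extA k A d (Q.Δ l) M)}

/-- The Weyl filtration dimension of `M`: the greatest `d` such that
`Ext^d(M, ∇ λ) ≠ 0` for some `λ ∈ Λ`. -/
noncomputable def wfd (M : ModuleCat.{u} A) : ℕ :=
  sSup {d | ∃ l, ¬ IsZero (extA k A d M (Q.nabla l))}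

/-- `wfd(A)`: the supremum of the Weyl filtration dimensions of all
finite-dimensional `A`-modules. -/
noncomputable def wfdAlg : ℕ :=
  sSup {d | ∃ M : ModuleCat.{u} A, Module.Finite A M ∧ Q.wfd M = d}

/-- `gfd(A)`: the supremum of the good filtration dimensions of all
finite-dimensional `A`-modules. -/
noncomputable def gfdAlg : ℕ :=
  sSup {d | ∃ M : ModuleCat.{u} A, Module.Finite A M ∧ Q.gfd M = d}

end QuasiHereditaryData

variable (k A) in
/-- The global dimension of `A`: the supremum of the `d` such that
`Ext^d(N, M) ≠ 0` for some finite-dimensional `A`-modules `N`, `M`. -/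
noncomputable def globAlg : ℕ :=
  sSup {d | ∃ N M : ModuleCat.{u} A, Module.Finite A N ∧ Module.Finite A M ∧
    ¬ IsZero (extA k A d N M)}

/-- the length `l(λ)`: the maximal `l` such that there is a chain
`μ₀ < μ₁ < ⋯ < μ_l = λ` in `Λ`. -/
noncomputable def chainLength (l : Λ) : ℕ :=
  sSup {d | ∃ c : Fin (d + 1) → Λ, StrictMono c ∧ c (Fin.last d) = l}


set_option linter.unusedSectionVars false
open CategoryTheory.Abelian

theorem isZero_extA_succ_iff (X Y : ModuleCat.{u} A) (n : ℕ) :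
    IsZero (extA k A (n + 1) X Y) ↔ Subsingleton (Ext X Y (n + 1)) := by
  let R := injectiveResolution Y
  let F := (linearCoyoneda k (ModuleCat.{u} A)).obj (op X)
  have h₁ : IsZero (extA k A (n + 1) X Y) ↔
      ∀ f : X ⟶ R.cocomplex.X (n + 1), f ≫ R.cocomplex.d (n + 1) (n + 2) = 0 →
        ∃ g : X ⟶ R.cocomplex.X n, g ≫ R.cocomplex.d n (n + 1) = f := by
    rw [extA, (R.isoRightDerivedObj F (n + 1)).isZero_iff]
    change IsZero (((F.mapHomologicalComplex _).obj R.cocomplex).homology (n + 1)) ↔ _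
    rw [← HomologicalComplex.exactAt_iff_isZero_homology,
      HomologicalComplex.exactAt_iff' _ n (n + 1) (n + 2) (by simp) (by simp),
      ShortComplex.moduleCat_exact_iff]
    rfl
  rw [h₁]
  constructor
  · intro h
    refine subsingleton_of_forall_eq 0 fun x => ?_
    obtain ⟨f, hf, rfl⟩ := R.extMk_surjective x (n + 2) rfl
    exact (R.extMk_eq_zero_iff f (n + 2) rfl hf n rfl).2 (h f hf)
  · intro h f hf
    exact (R.extMk_eq_zero_iff f (n + 2) rfl hf n rfl).1 (Subsingleton.elim _ _)


section ExtVanishing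

variable {C : Type*} [Category* C] [Abelian C] [HasExt.{u} C] {S : ShortComplex C}

theorem subsingleton_ext_of_isZero_left {X Y : C} (hX : IsZero X) (n : ℕ) :
    Subsingleton (Ext X Y n) :=
  subsingleton_of_forall_eq 0 fun x => by
    rw [← Ext.mk₀_id_comp x, hX.eq_of_src (𝟙 X) 0, Ext.mk₀_zero, Ext.zero_comp]

theorem subsingleton_ext_of_isZero_right {X Y : C} (hY : IsZero Y) (n : ℕ) :
    Subsingleton (Ext X Y n) :=
  subsingleton_of_forall_eq 0 fun x => by
    rw [← Ext.comp_mk₀_id x, hY.eq_of_src (𝟙 Y) 0, Ext.mk₀_zero, Ext.comp_zero]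

namespace CategoryTheory.ShortComplex.ShortExact

theorem subsingleton_ext_X₂ (hS : S.ShortExact) (X : C) (n : ℕ)
    [Subsingleton (Ext X S.X₁ n)] [Subsingleton (Ext X S.X₃ n)] :
    Subsingleton (Ext X S.X₂ n) :=
  subsingleton_of_forall_eq 0 fun x => by
    obtain ⟨y, rfl⟩ := Ext.covariant_sequence_exact₂ X hS x (Subsingleton.elim _ _)
    rw [Subsingleton.elim y 0, Ext.zero_comp]

theorem subsingleton_ext_X₃ (hS : S.ShortExact) (X : C) (n : ℕ)
    [Subsingleton (Ext X S.X₂ n)] [Subsingleton (Ext X S.X₁ (n + 1))] :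
    Subsingleton (Ext X S.X₃ n) :=
  subsingleton_of_forall_eq 0 fun x => by
    obtain ⟨y, rfl⟩ := Ext.covariant_sequence_exact₃ X hS x rfl (Subsingleton.elim _ _)
    rw [Subsingleton.elim y 0, Ext.zero_comp]

theorem subsingleton_ext_X₁ (hS : S.ShortExact) (X : C) (n : ℕ)
    [Subsingleton (Ext X S.X₃ n)] [Subsingleton (Ext X S.X₂ (n + 1))] :
    Subsingleton (Ext X S.X₁ (n + 1)) :=
  subsingleton_of_forall_eq 0 fun x => by
    obtain ⟨y, rfl⟩ := Ext.covariant_sequence_exact₁ X hS x (Subsingleton.elim _ _) rfl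
    rw [Subsingleton.elim y 0, Ext.zero_comp]

theorem subsingleton_ext_X₂_left (hS : S.ShortExact) (Y : C) (n : ℕ)
    [Subsingleton (Ext S.X₁ Y n)] [Subsingleton (Ext S.X₃ Y n)] :
    Subsingleton (Ext S.X₂ Y n) :=
  subsingleton_of_forall_eq 0 fun x => by
    obtain ⟨y, rfl⟩ := Ext.contravariant_sequence_exact₂ hS Y x (Subsingleton.elim _ _)
    rw [Subsingleton.elim y 0, Ext.comp_zero]

theorem subsingleton_ext_X₃_left (hS : S.ShortExact) (Y : C) (n : ℕ)
    [Subsingleton (Ext S.X₁ Y n)] [Subsingleton (Ext S.X₂ Y (n + 1))] :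
    Subsingleton (Ext S.X₃ Y (n + 1)) :=
  subsingleton_of_forall_eq 0 fun x => by
    obtain ⟨y, rfl⟩ := Ext.contravariant_sequence_exact₃ hS Y x (Subsingleton.elim _ _)
      (add_comm 1 n)
    rw [Subsingleton.elim y 0, Ext.comp_zero]

theorem exists_lift_of_subsingleton_ext (hS : S.ShortExact) {X : C}
    [Subsingleton (Ext X S.X₁ 1)] (f : X ⟶ S.X₃) : ∃ g : X ⟶ S.X₂, g ≫ S.g = f := by
  obtain ⟨x, hx⟩ := Ext.covariant_sequence_exact₃ X hS (Ext.mk₀ f) (zero_add 1)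
    (Subsingleton.elim _ _)
  obtain ⟨g, rfl⟩ := (Ext.mk₀_bijective X S.X₂).2 x
  exact ⟨g, (Ext.mk₀_bijective X S.X₃).1 (by simpa using hx)⟩

theorem exists_extension_of_subsingleton_ext (hS : S.ShortExact) {Y : C}
    [Subsingleton (Ext S.X₃ Y 1)] (f : S.X₁ ⟶ Y) : ∃ g : S.X₂ ⟶ Y, S.f ≫ g = f := by
  obtain ⟨x, hx⟩ := Ext.contravariant_sequence_exact₁ hS Y (Ext.mk₀ f) (add_zero 1)
    (Subsingleton.elim _ _)
  obtain ⟨g, rfl⟩ := (Ext.mk₀_bijective S.X₂ Y).2 x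
  exact ⟨g, (Ext.mk₀_bijective S.X₁ Y).1 (by simpa using hx)⟩

end CategoryTheory.ShortComplex.ShortExact

end ExtVanishing

section LinearMaps

variable {X Y Z : ModuleCat.{u} A}

/-- A short exact sequence of linear maps `0 → X → Y → Z → 0`. -/
structure IsShortExact (f : X →ₗ[A] Y) (g : Y →ₗ[A] Z) : Prop where
  injective : Function.Injective f
  exact : Function.Exact f g
  surjective : Function.Surjective g

namespace IsShortExact

variable {f : X →ₗ[A] Y} {g : Y →ₗ[A] Z}

theorem shortExact (h : IsShortExact f g) :
    (ShortComplex.mk (ModuleCat.ofHom f) (ModuleCat.ofHom g)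
      (by ext x; exact h.exact.apply_apply_eq_zero x)).ShortExact where
  exact := (ShortComplex.ShortExact.moduleCat_exact_iff_function_exact _).2 h.exact
  mono_f := (ModuleCat.mono_iff_injective _).2 h.injective
  epi_g := (ModuleCat.epi_iff_surjective _).2 h.surjective

theorem ker_subtype {g : Y →ₗ[A] Z} (hg : Function.Surjective g) :
    IsShortExact (X := ModuleCat.of A (LinearMap.ker g)) (LinearMap.ker g).subtype g where
  injective := Subtype.val_injective
  exact := LinearMap.exact_subtype_ker_map g
  surjective := hg

theorem range_mkQ {f : X →ₗ[A] Y} (hf : Function.Injective f) :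
    IsShortExact (Z := ModuleCat.of A (Y ⧸ LinearMap.range f)) f (LinearMap.range f).mkQ where
  injective := hf
  exact := LinearMap.exact_map_mkQ_range f
  surjective := Submodule.mkQ_surjective _

theorem exists_desc (h : IsShortExact f g) {W : ModuleCat.{u} A} (p : Y →ₗ[A] W)
    (hp : p ∘ₗ f = 0) : ∃ q : Z →ₗ[A] W, q ∘ₗ g = p := by
  refine ⟨(LinearMap.ker g).liftQ p ?_ ∘ₗ (g.quotKerEquivOfSurjective h.surjective).symm, ?_⟩
  · rw [LinearMap.exact_iff.1 h.exact]
    rintro _ ⟨x, rfl⟩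
    exact LinearMap.congr_fun hp x
  · ext y
    have : (g.quotKerEquivOfSurjective h.surjective).symm (g y) = Submodule.Quotient.mk y := by
      rw [LinearEquiv.symm_apply_eq]; rfl
    simp [this]

theorem exists_lift (h : IsShortExact f g) {W : ModuleCat.{u} A} [Subsingleton (Ext W X 1)]
    (p : W →ₗ[A] Z) : ∃ q : W →ₗ[A] Y, g ∘ₗ q = p := by
  obtain ⟨q, hq⟩ := h.shortExact.exists_lift_of_subsingleton_ext (ModuleCat.ofHom p)
  exact ⟨q.hom, congrArg ModuleCat.Hom.hom hq⟩

theorem exists_extension (h : IsShortExact f g) {W : ModuleCat.{u} A} [Subsingleton (Ext Z W 1)]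
    (p : X →ₗ[A] W) : ∃ q : Y →ₗ[A] W, q ∘ₗ f = p := by
  obtain ⟨q, hq⟩ := h.shortExact.exists_extension_of_subsingleton_ext (ModuleCat.ofHom p)
  exact ⟨q.hom, congrArg ModuleCat.Hom.hom hq⟩

end IsShortExact

end LinearMaps

theorem exists_finite_injective_embedding (K : Type u) [Field K] [Algebra K A]
    [FiniteDimensional K A] (M : ModuleCat.{u} A) [Module.Finite A M] :
    ∃ (I : ModuleCat.{u} A) (i : M ⟶ I), Injective I ∧ Module.Finite A I ∧ Mono i := by
  let F := ModuleCat.restrictScalars.{u} (algebraMap K A)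
  let adj := ModuleCat.restrictCoextendScalarsAdj.{u} (algebraMap K A)
  have : Injective (F.obj M) := by
    have := Module.injective_of_isSemisimpleRing K (F.obj M)
    exact Module.injective_object_of_injective_module K (F.obj M)
  have : Module.Finite K (F.obj (ModuleCat.of A A)) :=
    Module.Finite.equiv (M := A)
      { AddEquiv.refl A with map_smul' := fun c a => by simp [Algebra.smul_def]; rfl }
  have : Module.Finite K (F.obj M) := by
    let _ : Module K M := Module.compHom M (algebraMap K A)
    have : IsScalarTower K A M := ⟨fun c a m => by
      change (c • a) • m = algebraMap K A c • a • m
      rw [Algebra.smul_def, mul_smul]⟩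
    exact (Module.Finite.trans A M : Module.Finite K M)
  let W := F.obj (ModuleCat.of A A) →ₗ[K] F.obj M
  have hW (c : K) (g : W) (a : A) : g (c • a : A) = c • g a := by
    rw [Algebra.smul_def]
    exact g.map_smul c a
  have : IsScalarTower K A W := ⟨fun c a g => LinearMap.ext fun (x : A) =>
    (congrArg g (mul_smul_comm c x a)).trans (hW c g (x * a))⟩
  have : Module.Finite A W := Module.Finite.of_restrictScalars_finite K A W
  refine ⟨(ModuleCat.coextendScalars (algebraMap K A)).obj (F.obj M), adj.unit.app M,
    Injective.injective_of_adjoint adj _, ?_, inferInstance⟩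
  exact Module.Finite.equiv (ModuleCat.CoextendScalars.equiv (algebraMap K A) (F.obj M)).symm

namespace QuasiHereditaryData

variable (Q : QuasiHereditaryData k A Λ)

/-- Modules having a finite filtration with subquotients `Δ l`, `l ∈ S`. -/
inductive StdFiltered (S : Set Λ) : ModuleCat.{u} A → Prop
  | zero (M : ModuleCat.{u} A) : Subsingleton M → StdFiltered S M
  | ext {X Y : ModuleCat.{u} A} {l : Λ} (f : X →ₗ[A] Y) (g : Y →ₗ[A] Q.Δ l) :
      IsShortExact f g → l ∈ S → StdFiltered S X → StdFiltered S Y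

variable {Q}

theorem subsingleton_ext_Δ_nabla (n : ℕ) (l m : Λ) :
    Subsingleton (Ext (Q.Δ l) (Q.nabla m) (n + 1)) :=
  (isZero_extA_succ_iff (k := k) _ _ n).1 (Q.ext_delta_nabla (n + 1) n.succ_pos l m)

theorem subsingleton_ext_Δ_Δ {l m : Λ} (h : ¬ l < m) :
    Subsingleton (Ext (Q.Δ l) (Q.Δ m) 1) :=
  (isZero_extA_succ_iff (k := k) _ _ 0).1 (not_imp_comm.1 (Q.ext_delta_order l m) h)

theorem hom_Δ_nabla_eq_zero {l m : Λ} (h : l ≠ m) (f : Q.Δ l →ₗ[A] Q.nabla m) : f = 0 :=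
  have := Q.hom_ne l m h
  congrArg ModuleCat.Hom.hom (Subsingleton.elim (ModuleCat.ofHom f) 0)

theorem hom_Δ_Δ_eq_zero {l m : Λ} (h : ¬ l ≤ m) (f : Q.Δ l →ₗ[A] Q.Δ m) : f = 0 :=
  have := not_imp_comm.1 (Q.hom_delta_order l m) h
  congrArg ModuleCat.Hom.hom (Subsingleton.elim (ModuleCat.ofHom f) 0)

variable (Q) in
theorem exists_injective_L_nabla (l : Λ) :
    ∃ i : Q.L l →ₗ[A] Q.nabla l, Function.Injective i := by
  obtain ⟨i, _⟩ := Q.socleNabla l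
  exact ⟨i.hom, (ModuleCat.mono_iff_injective i).1 inferInstance⟩

variable (Q) in
theorem exists_surjective_Δ_L (l : Λ) :
    ∃ p : Q.Δ l →ₗ[A] Q.L l, Function.Surjective p := by
  obtain ⟨p, _⟩ := Q.headΔ l
  exact ⟨p.hom, (ModuleCat.epi_iff_surjective p).1 inferInstance⟩

theorem nontrivial_L (Q : QuasiHereditaryData k A Λ) (l : Λ) : Nontrivial (Q.L l) :=
  have := Q.simpleL l
  IsSimpleModule.nontrivial A (Q.L l)

theorem eq_of_hom_Δ_L_ne_zero {l m : Λ} {f : Q.Δ l →ₗ[A] Q.L m} (hf : f ≠ 0) : l = m := by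
  obtain ⟨i, hi⟩ := Q.exists_injective_L_nabla m
  by_contra h
  refine hf (LinearMap.ext fun x => hi ?_)
  simpa using LinearMap.congr_fun (hom_Δ_nabla_eq_zero h (i ∘ₗ f)) x

/-- `Hom(Δ l, ∇ l)` is spanned by any nonzero element. -/
theorem exists_smul_eq {l : Λ} (f g : Q.Δ l ⟶ Q.nabla l) (hf : f ≠ 0) : ∃ c : k, g = c • f := by
  obtain ⟨e⟩ := Q.hom_self l
  have hf' : e f ≠ 0 := by simpa using hf
  exact ⟨e g / e f, e.injective (by simp [hf'])⟩

theorem hom_comp_eq_zero {l : Λ} {f g : Q.Δ l →ₗ[A] Q.nabla l} (hf : f ≠ 0)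
    {W : ModuleCat.{u} A} (p : Q.nabla l →ₗ[A] W) (h : p ∘ₗ f = 0) : p ∘ₗ g = 0 := by
  obtain ⟨c, hc⟩ := exists_smul_eq (ModuleCat.ofHom f) (ModuleCat.ofHom g)
    fun h => hf (congrArg ModuleCat.Hom.hom h)
  have h' : ModuleCat.ofHom f ≫ ModuleCat.ofHom p = 0 := by ext x; exact LinearMap.congr_fun h x
  have : ModuleCat.ofHom g ≫ ModuleCat.ofHom p = 0 := by rw [hc, Linear.smul_comp, h', smul_zero]
  exact congrArg ModuleCat.Hom.hom this

namespace StdFiltered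

variable {S : Set Λ} {M : ModuleCat.{u} A}

theorem of_equiv (h : Q.StdFiltered S M) {N : ModuleCat.{u} A} (e : M ≃ₗ[A] N) :
    Q.StdFiltered S N := by
  cases h with
  | zero _ h => exact .zero _ e.symm.toEquiv.subsingleton
  | ext f g hfg hl hX =>
    refine .ext (e.toLinearMap ∘ₗ f) (g ∘ₗ e.symm.toLinearMap) ⟨?_, ?_, ?_⟩ hl hX
    · exact e.injective.comp hfg.injective
    · intro y
      rw [LinearMap.comp_apply, hfg.exact]
      simp [LinearEquiv.eq_symm_apply]
    · exact hfg.surjective.comp e.symm.surjective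

theorem mono (h : Q.StdFiltered S M) {S' : Set Λ} (hS : S ⊆ S') : Q.StdFiltered S' M := by
  induction h with
  | zero M h => exact .zero M h
  | ext f g hfg hl _ ih => exact .ext f g hfg (hS hl) ih

theorem subsingleton_ext (h : Q.StdFiltered S M) {l : Λ} (hl : ∀ j ∈ S, ¬ l < j) :
    Subsingleton (Ext (Q.Δ l) M 1) := by
  induction h with
  | zero M h => exact subsingleton_ext_of_isZero_right (ModuleCat.isZero_of_subsingleton M) 1
  | ext f g hfg hj _ ih =>
    have := subsingleton_ext_Δ_Δ (Q := Q) (hl _ hj)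
    exact hfg.shortExact.subsingleton_ext_X₂ (Q.Δ l) 1

theorem hom_eq_zero (h : Q.StdFiltered S M) {Y : ModuleCat.{u} A}
    (hY : ∀ l ∈ S, ∀ f : Q.Δ l →ₗ[A] Y, f = 0) (f : M →ₗ[A] Y) : f = 0 := by
  induction h with
  | zero M h => exact LinearMap.ext fun x => by simp [Subsingleton.elim x 0]
  | ext i p hip hl _ ih =>
    obtain ⟨q, rfl⟩ := hip.exists_desc f (ih _)
    rw [hY _ hl q, LinearMap.zero_comp]

theorem mem_of_hom_L_ne_zero (h : Q.StdFiltered S M) {m : Λ} {f : M →ₗ[A] Q.L m} (hf : f ≠ 0) :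
    m ∈ S := by
  contrapose! hf
  refine h.hom_eq_zero (fun l hl f => ?_) f
  by_contra hne
  exact hf (eq_of_hom_Δ_L_ne_zero hne ▸ hl)

/-- Splitting a standard filtration along an upper set of weights. -/
theorem exists_decomposition (h : Q.StdFiltered S M) (U : Set Λ)
    (hU : ∀ l ∈ S ∩ U, ∀ j ∈ S \ U, ¬ l < j) :
    ∃ (T B : ModuleCat.{u} A) (f : T →ₗ[A] M) (g : M →ₗ[A] B), IsShortExact f g ∧
      Q.StdFiltered (S ∩ U) T ∧ Q.StdFiltered (S \ U) B := by
  induction h with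
  | zero M h =>
    refine ⟨M, M, LinearMap.id, LinearMap.id, ⟨Function.injective_id, ?_, Function.surjective_id⟩,
      .zero M h, .zero M h⟩
    exact fun x => by simp [Subsingleton.elim x 0]
  | @ext X Y l i p hip hl _ ih =>
    obtain ⟨T, B, f, g, hfg, hT, hB⟩ := ih
    by_cases hlU : l ∈ U
    · have := hB.subsingleton_ext (l := l) fun j hj => hU l ⟨hl, hlU⟩ j hj
      obtain ⟨q, hq⟩ := hip.exists_extension g
      have hq' (x : X) : q (i x) = g x := LinearMap.congr_fun hq x
      have hqs : Function.Surjective q := fun b => by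
        obtain ⟨x, rfl⟩ := hfg.surjective b
        exact ⟨i x, hq' x⟩
      refine ⟨ModuleCat.of A (LinearMap.ker q), B, _, q, .ker_subtype hqs, ?_, hB⟩
      refine .ext (X := T) (l := l)
        ((i ∘ₗ f).codRestrict (LinearMap.ker q) fun t => ?_)
        (p ∘ₗ (LinearMap.ker q).subtype) ⟨fun t₁ t₂ ht => ?_, ?_, ?_⟩ ⟨hl, hlU⟩ hT
      · rw [LinearMap.mem_ker, LinearMap.comp_apply, hq', hfg.exact.apply_apply_eq_zero]
      · exact hfg.injective (hip.injective (congrArg Subtype.val ht))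
      · rintro ⟨y, hy⟩
        constructor
        · intro h
          obtain ⟨x, rfl⟩ := (hip.exact y).1 h
          obtain ⟨t, rfl⟩ := (hfg.exact x).1 (by rw [← hq']; exact hy)
          exact ⟨t, rfl⟩
        · rintro ⟨t, ht⟩
          have : y = i (f t) := congrArg Subtype.val ht.symm
          simp [this, hip.exact.apply_apply_eq_zero]
      · intro d
        obtain ⟨y, rfl⟩ := hip.surjective d
        obtain ⟨x, hx⟩ := hfg.surjective (q y)
        refine ⟨⟨y - i x, ?_⟩, ?_⟩
        · rw [LinearMap.mem_ker, map_sub, hq', hx, sub_self]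
        · simp [hip.exact.apply_apply_eq_zero]
    · have hif : Function.Injective (i ∘ₗ f) := hip.injective.comp hfg.injective
      refine ⟨T, ModuleCat.of A (Y ⧸ LinearMap.range (i ∘ₗ f)), i ∘ₗ f, _, .range_mkQ hif, hT, ?_⟩
      obtain ⟨a, ha⟩ := hfg.exists_desc (W := ModuleCat.of A (Y ⧸ LinearMap.range (i ∘ₗ f)))
        ((LinearMap.range (i ∘ₗ f)).mkQ ∘ₗ i) (by
          ext t
          exact (Submodule.Quotient.mk_eq_zero _).2 ⟨t, rfl⟩)
      have ha' (x : X) : a (g x) = Submodule.Quotient.mk (i x) := LinearMap.congr_fun ha x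
      obtain ⟨b, hb⟩ := (IsShortExact.range_mkQ hif).exists_desc p (by
        ext t
        exact hip.exact.apply_apply_eq_zero _)
      have hb' (y : Y) : b (Submodule.Quotient.mk y) = p y := LinearMap.congr_fun hb y
      refine .ext a b ⟨?_, ?_, ?_⟩ ⟨hl, hlU⟩ hB
      · rw [injective_iff_map_eq_zero]
        intro z hz
        obtain ⟨x, rfl⟩ := hfg.surjective z
        rw [ha'] at hz
        obtain ⟨t, ht⟩ := (Submodule.Quotient.mk_eq_zero _).1 hz
        rw [← hip.injective ht]
        exact hfg.exact.apply_apply_eq_zero t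
      · intro z
        obtain ⟨y, rfl⟩ := Submodule.Quotient.mk_surjective _ z
        rw [hb', hip.exact]
        constructor
        · rintro ⟨x, rfl⟩
          exact ⟨g x, ha' x⟩
        · rintro ⟨z, hz⟩
          obtain ⟨x, rfl⟩ := hfg.surjective z
          rw [ha', Submodule.Quotient.eq] at hz
          obtain ⟨t, ht⟩ := hz
          refine ⟨x - f t, ?_⟩
          rw [map_sub, ← LinearMap.comp_apply, ht, sub_sub_cancel]
      · intro d
        obtain ⟨y, rfl⟩ := hip.surjective d
        exact ⟨_, hb' y⟩

theorem exists_hom_Δ_comp_ne_zero {m : Λ} (h : Q.StdFiltered {m} M) {W : ModuleCat.{u} A}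
    {f : M →ₗ[A] W} (hf : f ≠ 0) : ∃ s : Q.Δ m →ₗ[A] M, f ∘ₗ s ≠ 0 := by
  induction h with
  | zero M h => exact absurd (LinearMap.ext fun x => by simp [Subsingleton.elim x 0]) hf
  | @ext X Y l i p hip hl hX ih =>
    by_cases hfi : f ∘ₗ i = 0
    · obtain rfl : l = m := hl
      have := hX.subsingleton_ext (l := l) fun j hj => hj ▸ lt_irrefl l
      obtain ⟨s, hs⟩ := hip.exists_lift LinearMap.id
      obtain ⟨q, rfl⟩ := hip.exists_desc f hfi
      refine ⟨s, fun h => hf ?_⟩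
      rw [LinearMap.comp_assoc, hs, LinearMap.comp_id] at h
      rw [h, LinearMap.zero_comp]
    · obtain ⟨s, hs⟩ := ih hfi
      exact ⟨i ∘ₗ s, hs⟩

end StdFiltered

variable (Q) in
theorem stdFiltered_self : Q.StdFiltered Set.univ (ModuleCat.of A A) := by
  obtain ⟨n, c, hc, h0, hn, h⟩ := Q.A_filtered
  suffices ∀ i, Q.StdFiltered Set.univ (ModuleCat.of A (c i)) from
    (this (Fin.last n)).of_equiv ((LinearEquiv.ofEq _ _ hn).trans Submodule.topEquiv)
  intro i
  induction i using Fin.induction with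
  | zero => exact .zero _ (by rw [h0]; exact inferInstanceAs (Subsingleton (⊥ : Submodule A A)))
  | succ i ih =>
    obtain ⟨_, ⟨l, rfl⟩, ⟨e⟩⟩ := h i
    have hle : c i.castSucc ≤ c i.succ := hc i.castSucc_le_succ
    refine .ext (l := l) (Submodule.inclusion hle)
      (e.toLinearMap ∘ₗ Submodule.mkQ _) ⟨Submodule.inclusion_injective hle, ?_, ?_⟩
      (Set.mem_univ l) ih
    · intro x
      simp only [LinearMap.comp_apply, LinearEquiv.coe_coe, Submodule.mkQ_apply,
        LinearEquiv.map_eq_zero_iff, Submodule.Quotient.mk_eq_zero, Submodule.mem_comap]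
      exact ⟨fun hx => ⟨⟨x, hx⟩, rfl⟩, by rintro ⟨y, rfl⟩; exact y.2⟩
    · exact e.surjective.comp (Submodule.mkQ_surjective _)

end QuasiHereditaryData

namespace QuasiHereditaryData

variable {Q : QuasiHereditaryData k A Λ}

section Simple

variable (Q)

theorem exists_surjective_hom_L (M : ModuleCat.{u} A) [Module.Finite A M] [Nontrivial M] :
    ∃ (l : Λ) (p : M →ₗ[A] Q.L l), Function.Surjective p := by
  obtain ⟨N, hN, -⟩ := (eq_top_or_exists_le_coatom (⊥ : Submodule A M)).resolve_left bot_ne_top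
  have := isSimpleModule_iff_isCoatom.2 hN
  obtain ⟨l, ⟨e⟩⟩ := Q.simple_complete (ModuleCat.of A (M ⧸ N)) inferInstance inferInstance
  exact ⟨l, e.toLinearEquiv.toLinearMap ∘ₗ N.mkQ,
    e.toLinearEquiv.surjective.comp N.mkQ_surjective⟩

theorem exists_injective_L_hom (M : ModuleCat.{u} A) [Module.Finite A M] [Nontrivial M] :
    ∃ (l : Λ) (i : Q.L l →ₗ[A] M), Function.Injective i := by
  have : IsArtinianRing A := IsArtinianRing.of_finite k A
  obtain ⟨N, hN, -⟩ := (eq_bot_or_exists_atom_le (⊤ : Submodule A M)).resolve_left top_ne_bot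
  have := isSimpleModule_iff_isAtom.2 hN
  obtain ⟨l, ⟨e⟩⟩ := Q.simple_complete (ModuleCat.of A N) inferInstance inferInstance
  exact ⟨l, N.subtype ∘ₗ e.toLinearEquiv.symm.toLinearMap,
    N.injective_subtype.comp e.toLinearEquiv.symm.injective⟩

end Simple

variable (Q) in
/-- Every composition factor of `M` is of the form `L m` with `m ∈ V`. -/
def FactorsIn (V : Set Λ) (M : ModuleCat.{u} A) : Prop :=
  ∀ (N : ModuleCat.{u} A) (i : N →ₗ[A] M), Function.Injective i →
    ∀ (m : Λ) (p : N →ₗ[A] Q.L m), p ≠ 0 → m ∈ V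

theorem FactorsIn.of_injective {V : Set Λ} {M N : ModuleCat.{u} A} (h : Q.FactorsIn V M)
    {i : N →ₗ[A] M} (hi : Function.Injective i) : Q.FactorsIn V N :=
  fun N' j hj m p hp => h N' (i ∘ₗ j) (hi.comp hj) m p hp

theorem FactorsIn.of_surjective {V : Set Λ} {M N : ModuleCat.{u} A} (h : Q.FactorsIn V M)
    {g : M →ₗ[A] N} (hg : Function.Surjective g) : Q.FactorsIn V N := by
  intro N' j hj m p hp
  let e := LinearEquiv.ofInjective j hj
  let K := (LinearMap.range j).comap g
  let r : K →ₗ[A] LinearMap.range j := g.restrict fun _ hx => hx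
  refine h (ModuleCat.of A K) K.subtype K.injective_subtype m (p ∘ₗ e.symm.toLinearMap ∘ₗ r)
    fun h0 => hp (LinearMap.ext fun x => ?_)
  obtain ⟨y, hy⟩ := hg (j x)
  have : e.symm (r ⟨y, x, hy.symm⟩) = x := by
    rw [LinearEquiv.symm_apply_eq]
    exact Subtype.ext hy
  simpa [this] using LinearMap.congr_fun h0 ⟨y, x, hy.symm⟩

/-- If no `Δ l` with `l ∉ V` maps nontrivially to `Y`, then the nonzero maps from `Y` are detected
on modules filtered by the `Δ l` with `l ∈ V`. -/
theorem exists_stdFiltered_comp_ne_zero {V : Set Λ} (hV : IsLowerSet V) {Y W : ModuleCat.{u} A}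
    (hY : ∀ l ∉ V, ∀ f : Q.Δ l →ₗ[A] Y, f = 0) {h : Y →ₗ[A] W} (hh : h ≠ 0) :
    ∃ (B : ModuleCat.{u} A) (b : B →ₗ[A] Y), Q.StdFiltered V B ∧ h ∘ₗ b ≠ 0 := by
  obtain ⟨T, B, f, g, hfg, hT, hB⟩ := Q.stdFiltered_self.exists_decomposition Vᶜ
    fun l hl j hj hlj => hl.2 (hV hlj.le (by simpa using hj.2))
  obtain ⟨y, hy⟩ : ∃ y, h y ≠ 0 := by
    by_contra! h0
    exact hh (LinearMap.ext h0)
  obtain ⟨b, hb⟩ := hfg.exists_desc (LinearMap.toSpanSingleton A Y y)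
    (hT.hom_eq_zero (fun l hl => hY l hl.2) _)
  refine ⟨B, b, hB.mono (by simp), fun h0 => hy ?_⟩
  have hby : b (g (1 : A)) = y := by simpa using LinearMap.congr_fun hb (1 : A)
  rw [← hby]
  exact LinearMap.congr_fun h0 _

theorem factorsIn_of_hom_Δ_eq_zero {V : Set Λ} (hV : IsLowerSet V) {Y : ModuleCat.{u} A}
    (hY : ∀ l ∉ V, ∀ f : Q.Δ l →ₗ[A] Y, f = 0) : Q.FactorsIn V Y := by
  intro N i hi m p hp
  obtain ⟨B, b, hB, hb⟩ := exists_stdFiltered_comp_ne_zero (Q := Q) hV (Y := N)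
    (fun l hl f => LinearMap.ext fun x => hi (by
      simpa using LinearMap.congr_fun (hY l hl (i ∘ₗ f)) x)) hp
  exact hB.mem_of_hom_L_ne_zero hb

theorem exists_hom_Δ_comp_ne_zero {m : Λ} {Y : ModuleCat.{u} A}
    (hY : ∀ l, ¬ l ≤ m → ∀ f : Q.Δ l →ₗ[A] Y, f = 0) {h : Y →ₗ[A] Q.L m} (hh : h ≠ 0) :
    ∃ s : Q.Δ m →ₗ[A] Y, h ∘ₗ s ≠ 0 := by
  obtain ⟨B, b, hB, hb⟩ := exists_stdFiltered_comp_ne_zero (isLowerSet_Iic m) hY hh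
  obtain ⟨D, B', f, g, hfg, hD, hB'⟩ := hB.exists_decomposition {m} (by
    rintro l ⟨-, rfl⟩ j ⟨hj, -⟩ hlt
    exact hlt.not_ge hj)
  have hne : (h ∘ₗ b) ∘ₗ f ≠ 0 := fun h0 => by
    obtain ⟨q, hq⟩ := hfg.exists_desc _ h0
    have hq0 : q ≠ 0 := by
      rintro rfl
      exact hb (by rw [← hq, LinearMap.zero_comp])
    exact (hB'.mem_of_hom_L_ne_zero hq0).2 rfl
  obtain ⟨s, hs⟩ := (hD.mono Set.inter_subset_right).exists_hom_Δ_comp_ne_zero hne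
  exact ⟨b ∘ₗ f ∘ₗ s, hs⟩

variable (Q) in
theorem factorsIn_Δ (m : Λ) : Q.FactorsIn (Set.Iic m) (Q.Δ m) :=
  factorsIn_of_hom_Δ_eq_zero (isLowerSet_Iic m) fun _ hl f => hom_Δ_Δ_eq_zero hl f

variable (Q) in
theorem factorsIn_nabla (m : Λ) : Q.FactorsIn (Set.Iic m) (Q.nabla m) :=
  factorsIn_of_hom_Δ_eq_zero (isLowerSet_Iic m) fun _ hl f =>
    hom_Δ_nabla_eq_zero (fun h => hl h.le) f

/-- The composition factors of `∇ m / L m` are of the form `L l` with `l < m`. -/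
theorem factorsIn_nabla_quotient {m : Λ} {Z : ModuleCat.{u} A} {i : Q.L m →ₗ[A] Q.nabla m}
    {g : Q.nabla m →ₗ[A] Z} (hig : IsShortExact i g) : Q.FactorsIn (Set.Iio m) Z := by
  refine factorsIn_of_hom_Δ_eq_zero (isLowerSet_Iio m) fun l hl f => ?_
  by_contra hf
  have := Q.finΔ l
  have hfr : f.rangeRestrict ≠ 0 := fun h =>
    hf (LinearMap.ext fun x => congrArg Subtype.val (LinearMap.congr_fun h x))
  have : Nontrivial (LinearMap.range f) := by
    by_contra hn
    rw [not_nontrivial_iff_subsingleton] at hn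
    exact hfr (LinearMap.ext fun x => Subsingleton.elim _ _)
  obtain ⟨l', q, hq⟩ := Q.exists_surjective_hom_L (ModuleCat.of A (LinearMap.range f))
  have hL := Q.nontrivial_L l'
  have hqf : q ∘ₗ f.rangeRestrict ≠ 0 := fun h => by
    obtain ⟨z, hz⟩ := exists_ne (0 : Q.L l')
    obtain ⟨y, rfl⟩ := hq z
    obtain ⟨x, rfl⟩ := f.surjective_rangeRestrict y
    exact hz (LinearMap.congr_fun h x)
  obtain rfl := eq_of_hom_Δ_L_ne_zero hqf
  let E := ModuleCat.of A ((LinearMap.range f).comap g)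
  let ι : E →ₗ[A] Q.nabla m := Submodule.subtype _
  have hι : Function.Injective ι := Subtype.val_injective
  let r : E →ₗ[A] LinearMap.range f := g.restrict fun _ hx => hx
  have hr (x : E) : (r x : Z) = g (ι x) := rfl
  have hrs : Function.Surjective r := by
    rintro ⟨z, hz⟩
    obtain ⟨y, rfl⟩ := hig.surjective z
    exact ⟨⟨y, hz⟩, rfl⟩
  have hqr : q ∘ₗ r ≠ 0 := fun h => by
    obtain ⟨z, hz⟩ := exists_ne (0 : Q.L l)
    obtain ⟨y, rfl⟩ := hq z
    obtain ⟨x, rfl⟩ := hrs y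
    exact hz (LinearMap.congr_fun h x)
  have hlm : l ≤ m := Q.factorsIn_nabla m E ι hι l (q ∘ₗ r) hqr
  obtain rfl : l = m := by
    by_contra hne
    exact hl (lt_of_le_of_ne hlm hne)
  have hE (l') (hl' : ¬ l' ≤ l) (a : Q.Δ l' →ₗ[A] E) : a = 0 := LinearMap.ext fun x => hι <| by
    simpa using LinearMap.congr_fun (hom_Δ_nabla_eq_zero (fun h => hl' h.le) (ι ∘ₗ a)) x
  obtain ⟨s, hs⟩ := exists_hom_Δ_comp_ne_zero hE hqr
  obtain ⟨p, hp⟩ := Q.exists_surjective_Δ_L l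
  have hip : i ∘ₗ p ≠ 0 := fun h => by
    obtain ⟨z, hz⟩ := exists_ne (0 : Q.L l)
    obtain ⟨x, rfl⟩ := hp z
    exact hz (hig.injective (by simpa using LinearMap.congr_fun h x))
  have hgι : g ∘ₗ (ι ∘ₗ s) = 0 := hom_comp_eq_zero hip g (by
    ext x
    exact hig.exact.apply_apply_eq_zero _)
  refine hs (LinearMap.ext fun x => ?_)
  have : r (s x) = 0 := Subtype.ext (LinearMap.congr_fun hgι x)
  simp [this]

/-- Dévissage along composition factors. -/
theorem FactorsIn.subsingleton_ext {V : Set Λ} {M : ModuleCat.{u} A} [Module.Finite A M]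
    (hM : Q.FactorsIn V M) {C : ModuleCat.{u} A} {n : ℕ}
    (hC : ∀ l ∈ V, Subsingleton (Ext (Q.L l) C n)) : Subsingleton (Ext M C n) := by
  have : IsArtinianRing A := IsArtinianRing.of_finite k A
  induction hn : Module.length A M using WellFoundedLT.induction generalizing M with
  | ind a ih =>
    rcases subsingleton_or_nontrivial M with hs | hs
    · exact subsingleton_ext_of_isZero_left (ModuleCat.isZero_of_subsingleton M) n
    · obtain ⟨l, p, hp⟩ := Q.exists_surjective_hom_L M
      have hL := Q.nontrivial_L l
      have hp0 : p ≠ 0 := by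
        rintro rfl
        obtain ⟨z, hz⟩ := exists_ne (0 : Q.L l)
        obtain ⟨y, rfl⟩ := hp z
        exact hz rfl
      have := hC l (hM M LinearMap.id Function.injective_id l p hp0)
      have hker := IsShortExact.ker_subtype hp
      have := ih _ (hn ▸ Submodule.length_lt (by rwa [Ne, LinearMap.ker_eq_top]))
        (hM.of_injective hker.injective) rfl
      exact hker.shortExact.subsingleton_ext_X₂_left C n

/-- A nonzero module `C` with `Ext¹(Δ l, C) = 0` for all `l` contains some `∇ m`. -/
theorem exists_injective_nabla_hom (C : ModuleCat.{u} A) [Module.Finite A C] [Nontrivial C]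
    (hC : ∀ l, Subsingleton (Ext (Q.Δ l) C 1)) :
    ∃ (m : Λ) (i : Q.nabla m →ₗ[A] C), Function.Injective i := by
  have : IsArtinianRing A := IsArtinianRing.of_finite k A
  obtain ⟨m, ⟨j, hj⟩, hm⟩ := WellFounded.has_min (wellFounded_lt (α := Λ))
    {l | ∃ i : Q.L l →ₗ[A] C, Function.Injective i} (Q.exists_injective_L_hom C)
  have hext (l) (hl : l ∈ Set.Iio m) : Subsingleton (Ext (Q.L l) C 1) := by
    obtain ⟨p, hp⟩ := Q.exists_surjective_Δ_L l
    have hker := IsShortExact.ker_subtype hp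
    have hfac := (Q.factorsIn_Δ l).of_injective hker.injective
    have hhom (f : ModuleCat.of A (LinearMap.ker p) →ₗ[A] C) : f = 0 := by
      by_contra hf
      have : Nontrivial (LinearMap.range f) := by
        by_contra hn
        rw [not_nontrivial_iff_subsingleton] at hn
        exact hf (LinearMap.ext fun x => congrArg Subtype.val
          (Subsingleton.elim (f.rangeRestrict x) 0))
      obtain ⟨l', i, hi⟩ := Q.exists_injective_L_hom (ModuleCat.of A (LinearMap.range f))
      have hL := Q.nontrivial_L l'
      have hl' : l' ≤ l := (hfac.of_surjective (N := ModuleCat.of A (LinearMap.range f))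
        f.surjective_rangeRestrict).of_injective hi _ LinearMap.id Function.injective_id l'
        LinearMap.id fun h => by
          obtain ⟨z, hz⟩ := exists_ne (0 : Q.L l')
          exact hz (LinearMap.congr_fun h z)
      exact hm l' ⟨(LinearMap.range f).subtype ∘ₗ i, Subtype.val_injective.comp hi⟩
        (hl'.trans_lt hl)
    have : Subsingleton (Ext (ModuleCat.of A (LinearMap.ker p)) C 0) := by
      refine (Ext.homEquiv₀ (C := ModuleCat.{u} A)).subsingleton_congr.2
        (subsingleton_of_forall_eq 0 fun f => ?_)
      ext x
      exact LinearMap.congr_fun (hhom f.hom) x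
    have := hC l
    exact hker.shortExact.subsingleton_ext_X₃_left C 0
  obtain ⟨i, hi⟩ := Q.exists_injective_L_nabla m
  have hq := IsShortExact.range_mkQ hi
  have := Q.finNabla m
  have := (factorsIn_nabla_quotient hq).subsingleton_ext hext
  obtain ⟨a, ha⟩ := hq.exists_extension j
  refine ⟨m, a, ?_⟩
  rw [← LinearMap.ker_eq_bot]
  by_contra hker
  have := Submodule.nontrivial_iff_ne_bot.2 hker
  obtain ⟨l, b, hb⟩ := Q.exists_injective_L_hom (ModuleCat.of A (LinearMap.ker a))
  obtain ⟨p, hp⟩ := Q.exists_surjective_Δ_L l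
  let b' : Q.L l →ₗ[A] Q.nabla m := (LinearMap.ker a).subtype ∘ₗ b
  have hb' : Function.Injective b' := Subtype.val_injective.comp hb
  have hL := Q.nontrivial_L l
  have hbp : b' ∘ₗ p ≠ 0 := fun h => by
    obtain ⟨z, hz⟩ := exists_ne (0 : Q.L l)
    obtain ⟨x, rfl⟩ := hp z
    exact hz (hb' (by simpa using LinearMap.congr_fun h x))
  obtain rfl : l = m := by
    by_contra hne
    exact hbp (hom_Δ_nabla_eq_zero hne _)
  have h0 : a ∘ₗ (i ∘ₗ p) = 0 := hom_comp_eq_zero hbp a (LinearMap.ext fun x => (b (p x)).2)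
  obtain ⟨z, hz⟩ := exists_ne (0 : Q.L l)
  obtain ⟨x, rfl⟩ := hp z
  refine hz (hj ?_)
  rw [← ha, map_zero]
  exact LinearMap.congr_fun h0 x

/-- If `N` has Weyl filtration dimension at most `a` and `C` is right orthogonal to all `Δ l`, then
`Ext^n(N, C) = 0` for `n > a`. -/
theorem subsingleton_ext_of_orthogonal {N C : ModuleCat.{u} A} [Module.Finite A C] {n : ℕ}
    (hN : ∀ l, Subsingleton (Ext N (Q.nabla l) n))
    (hC : ∀ l i, Subsingleton (Ext (Q.Δ l) C (i + 1))) : Subsingleton (Ext N C n) := by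
  have : IsArtinianRing A := IsArtinianRing.of_finite k A
  induction hlen : Module.length A C using WellFoundedLT.induction generalizing C with
  | ind _ ih =>
    rcases subsingleton_or_nontrivial C with hs | hs
    · exact subsingleton_ext_of_isZero_right (ModuleCat.isZero_of_subsingleton C) n
    · obtain ⟨m, i, hi⟩ := exists_injective_nabla_hom C fun l => hC l 0
      have hq := IsShortExact.range_mkQ hi
      have hne : LinearMap.range i ≠ ⊥ := by
        rw [Ne, LinearMap.range_eq_bot]
        rintro rfl
        obtain ⟨j, hj⟩ := Q.exists_injective_L_nabla m
        have := Q.nontrivial_L m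
        obtain ⟨z, hz⟩ := exists_ne (0 : Q.L m)
        exact hz (hj (hi rfl))
      have := ih _ (hlen ▸ Submodule.length_quotient_lt (LinearMap.range i) hne)
        (C := ModuleCat.of A (C ⧸ LinearMap.range i)) (fun l d => by
          have := hC l d
          have := subsingleton_ext_Δ_nabla (Q := Q) (d + 1) l m
          exact hq.shortExact.subsingleton_ext_X₃ (Q.Δ l) (d + 1)) rfl
      have := hN m
      exact hq.shortExact.subsingleton_ext_X₂ N n

theorem subsingleton_ext_of_lt {a b : ℕ} {N M : ModuleCat.{u} A} [Module.Finite A M]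
    (hN : ∀ l n, a < n → Subsingleton (Ext N (Q.nabla l) n))
    (hM : ∀ l n, b < n → Subsingleton (Ext (Q.Δ l) M n)) {n : ℕ} (hn : a + b < n) :
    Subsingleton (Ext N M n) := by
  induction b generalizing M n with
  | zero =>
    exact subsingleton_ext_of_orthogonal (fun l => hN l n hn) fun l i => hM l _ i.succ_pos
  | succ b ih =>
    obtain ⟨I, i, hI, _, hi⟩ := exists_finite_injective_embedding k M
    have hq := (IsShortExact.range_mkQ ((ModuleCat.mono_iff_injective i).1 hi)).shortExact
    obtain ⟨n, rfl⟩ : ∃ d, n = d + 1 + 1 := ⟨n - 2, by omega⟩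
    have : Subsingleton (Ext N I (n + 1 + 1)) := Ext.subsingleton_of_injective N I (n + 1)
    have : Subsingleton (Ext N (ModuleCat.of A (I ⧸ LinearMap.range i.hom)) (n + 1)) := by
      refine ih (fun l d hd => ?_) (by omega)
      obtain ⟨d, rfl⟩ : ∃ e, d = e + 1 := ⟨d - 1, by omega⟩
      have := hM l (d + 1 + 1) (by omega)
      have : Subsingleton (Ext (Q.Δ l) I (d + 1)) := Ext.subsingleton_of_injective _ I d
      exact hq.subsingleton_ext_X₃ (Q.Δ l) (d + 1)
    exact hq.subsingleton_ext_X₁ N (n + 1)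

end QuasiHereditaryData

/-- Let `A` be a finite-dimensional quasi-hereditary algebra over a
field. Then the global dimension of `A` is at most `wfd(A) + gfd(A)`, where
`wfd(A)` and `gfd(A)` are the suprema of the Weyl filtration dimensions and good
filtration dimensions, respectively, of all finite-dimensional `A`-modules. -/
theorem globalDimension_le_wfd_add_gfd
    (Q : QuasiHereditaryData k A Λ) :
    globAlg k A ≤ Q.wfdAlg + Q.gfdAlg := by
  by_cases hbdd : BddAbove {d | ∃ N M : ModuleCat.{u} A, Module.Finite A N ∧ Module.Finite A M ∧
    ¬ IsZero (extA k A d N M)}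
  swap
  · rw [globAlg, Nat.sSup_of_not_bddAbove hbdd]
    exact Nat.zero_le _
  obtain ⟨D, hD⟩ := hbdd
  have hw (N : ModuleCat.{u} A) (hN : Module.Finite A N) (l : Λ) (n : ℕ) (hn : Q.wfdAlg < n) :
      IsZero (extA k A n N (Q.nabla l)) := by
    by_contra h
    have hle : n ≤ Q.wfd N := le_csSup
      ⟨D, fun d ⟨l, hl⟩ => hD ⟨N, Q.nabla l, hN, Q.finNabla l, hl⟩⟩ ⟨l, h⟩
    have hle' : Q.wfd N ≤ Q.wfdAlg := le_csSup ⟨D, fun d ⟨N, hN, hd⟩ => hd ▸ csSup_le'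
      fun d ⟨l, hl⟩ => hD ⟨N, Q.nabla l, hN, Q.finNabla l, hl⟩⟩ ⟨N, hN, rfl⟩
    exact (hle.trans hle').not_gt hn
  have hg (M : ModuleCat.{u} A) (hM : Module.Finite A M) (l : Λ) (n : ℕ) (hn : Q.gfdAlg < n) :
      IsZero (extA k A n (Q.Δ l) M) := by
    by_contra h
    have hle : n ≤ Q.gfd M := le_csSup
      ⟨D, fun d ⟨l, hl⟩ => hD ⟨Q.Δ l, M, Q.finΔ l, hM, hl⟩⟩ ⟨l, h⟩
    have hle' : Q.gfd M ≤ Q.gfdAlg := le_csSup ⟨D, fun d ⟨M, hM, hd⟩ => hd ▸ csSup_le'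
      fun d ⟨l, hl⟩ => hD ⟨Q.Δ l, M, Q.finΔ l, hM, hl⟩⟩ ⟨M, hM, rfl⟩
    exact (hle.trans hle').not_gt hn
  refine csSup_le' fun d ⟨N, M, hN, hM, hd⟩ => not_lt.1 fun hlt => hd ?_
  have key {X Y : ModuleCat.{u} A} {n : ℕ} (hn : n ≠ 0) :
      IsZero (extA k A n X Y) ↔ Subsingleton (Ext X Y n) := by
    obtain ⟨n, rfl⟩ := Nat.exists_eq_succ_of_ne_zero hn
    exact isZero_extA_succ_iff X Y n
  exact (key (by omega)).2 (QuasiHereditaryData.subsingleton_ext_of_lt (Q := Q)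
    (fun l n hn => (key (by omega)).1 (hw N hN l n hn))
    (fun l n hn => (key (by omega)).1 (hg M hM l n hn)) hlt)
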